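/- Let 𝒯 be a stubborn set assignment satisfying D0, D1 and D2, assume the system is AG EF terminating, and let t_s be a transition. Then t_s is enabled at some reachable state if and only if t_s is enabled at some r-state. -/

import Mathlib

/-- `TPath step s σ s'` means `s →[σ] s'`: firing the sequence `σ` of transitions
from `s` yields `s'`. -/
inductive TPath {S T : Type*} (step : S → T → S → Prop) : S → List T → S → Prop
  | nil (s : S) : TPath step s [] s
  | cons {s s' s'' : S} {t : T} {σ : List T} :
      step s t s' → TPath step s' σ s'' → TPath step s (t :: σ) s''

/-- Transition `t` is enabled at `s`. -/
def Enabled {S T : Type*} (step : S → T → S → Prop) (s : S) (t : T) : Prop :=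
  ∃ s', step s t s'

/-- A state is terminal iff no transition is enabled at it. -/
def Terminal {S T : Type*} (step : S → T → S → Prop) (s : S) : Prop :=
  ∀ t, ¬ Enabled step s t

/-- `s'` is reachable from `s`. -/
def Reachable {S T : Type*} (step : S → T → S → Prop) (s s' : S) : Prop :=
  ∃ σ, TPath step s σ s'

/-- An r-edge: a step `s →[t] s'` with `t ∈ 𝒯 s`. -/
def REdge {S T : Type*} (step : S → T → S → Prop) (𝒯 : S → Set T)
    (s : S) (t : T) (s' : S) : Prop :=
  step s t s' ∧ t ∈ 𝒯 s

/-- The transition relation is deterministic. -/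
def Deterministic {S T : Type*} (step : S → T → S → Prop) : Prop :=
  ∀ s t s₁ s₂, step s t s₁ → step s t s₂ → s₁ = s₂

/-- D0: if `s₀` is not terminal then `𝒯 s₀` contains an enabled transition. -/
def D0 {S T : Type*} (step : S → T → S → Prop) (𝒯 : S → Set T) : Prop :=
  ∀ s₀, ¬ Terminal step s₀ → ∃ t ∈ 𝒯 s₀, Enabled step s₀ t

/-- D1: if `t ∈ 𝒯 s₀`, `t₁,…,tₙ ∉ 𝒯 s₀` and `s₀ →[t₁⋯tₙ t] s'`
then `s₀ →[t t₁⋯tₙ] s'`. -/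
def D1 {S T : Type*} (step : S → T → S → Prop) (𝒯 : S → Set T) : Prop :=
  ∀ s₀ t σ s', t ∈ 𝒯 s₀ → (∀ u ∈ σ, u ∉ 𝒯 s₀) →
    TPath step s₀ (σ ++ [t]) s' → TPath step s₀ (t :: σ) s'

/-- D2: if `t ∈ 𝒯 s₀` is enabled at `s₀`, `t₁,…,tₙ ∉ 𝒯 s₀` and `s₀ →[t₁⋯tₙ] sₙ`
then `t` is enabled at `sₙ`. -/
def D2 {S T : Type*} (step : S → T → S → Prop) (𝒯 : S → Set T) : Prop :=
  ∀ s₀ t σ sₙ, t ∈ 𝒯 s₀ → Enabled step s₀ t → (∀ u ∈ σ, u ∉ 𝒯 s₀) →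
    TPath step s₀ σ sₙ → Enabled step sₙ t

theorem TPath.append {S T : Type*} {step : S → T → S → Prop} {s s' s'' : S} {σ τ : List T}
    (h : TPath step s σ s') (h' : TPath step s' τ s'') : TPath step s (σ ++ τ) s'' := by
  induction h with
  | nil => exact h'
  | cons hs _ ih => exact .cons hs (ih h')

theorem TPath.exists_of_append {S T : Type*} {step : S → T → S → Prop} {s s'' : S}
    {σ τ : List T} (h : TPath step s (σ ++ τ) s'') :
    ∃ s', TPath step s σ s' ∧ TPath step s' τ s'' := by
  induction σ generalizing s with
  | nil => exact ⟨s, .nil s, h⟩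
  | cons t σ ih =>
    cases h with
    | cons hs h =>
      obtain ⟨s', h₁, h₂⟩ := ih h
      exact ⟨s', .cons hs h₁, h₂⟩

theorem TPath.mono {S T : Type*} {step step' : S → T → S → Prop}
    (hle : ∀ s t s', step s t s' → step' s t s') {s s' : S} {σ : List T}
    (h : TPath step s σ s') : TPath step' s σ s' := by
  induction h with
  | nil => exact .nil _
  | cons hs _ ih => exact .cons (hle _ _ _ hs) ih

/-- A list meeting `A` splits at its first element in `A`. -/
theorem List.exists_eq_append_cons_first_mem {T : Type*} (A : Set T) {σ : List T}
    (h : ∃ t ∈ σ, t ∈ A) :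
    ∃ σ₁ t σ₂, σ = σ₁ ++ t :: σ₂ ∧ t ∈ A ∧ ∀ u ∈ σ₁, u ∉ A := by
  induction σ with
  | nil => simp at h
  | cons a σ ih =>
    by_cases ha : a ∈ A
    · exact ⟨[], a, σ, rfl, ha, by simp⟩
    · obtain ⟨σ₁, t, σ₂, rfl, ht, hσ₁⟩ := ih (by simpa [ha] using h)
      exact ⟨a :: σ₁, t, σ₂, rfl, ht, by simpa [ha] using hσ₁⟩

/-- A path to a terminal state can be rearranged so that it starts with an r-edge. -/
theorem TPath.exists_rEdge_of_terminal {S T : Type*} {step : S → T → S → Prop}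
    {𝒯 : S → Set T} (h0 : D0 step 𝒯) (h1 : D1 step 𝒯) (h2 : D2 step 𝒯) {s z : S}
    {σ : List T} (hσ : TPath step s σ z) (hz : Terminal step z) (hs : ¬ Terminal step s) :
    ∃ t s' τ, REdge step 𝒯 s t s' ∧ TPath step s' τ z ∧ σ.Perm (t :: τ) := by
  obtain ⟨t₀, ht₀, hen⟩ := h0 s hs
  have hmeet : ∃ t ∈ σ, t ∈ 𝒯 s := by
    by_contra! hno
    exact hz t₀ (h2 s t₀ σ z ht₀ hen hno hσ)
  obtain ⟨σ₁, t, σ₂, rfl, ht, hσ₁⟩ := List.exists_eq_append_cons_first_mem _ hmeet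
  rw [List.append_cons] at hσ
  obtain ⟨s₁, hp₁, hp₂⟩ := hσ.exists_of_append
  cases h1 s t σ₁ s₁ ht hσ₁ hp₁ with
  | cons hst hp => exact ⟨t, _, σ₁ ++ σ₂, ⟨hst, ht⟩, hp.append hp₂, List.perm_middle⟩

/-- Every transition on a path to a terminal state gets enabled along r-edges. -/
theorem TPath.exists_reachable_rEdge_enabled {S T : Type*} {step : S → T → S → Prop}
    {𝒯 : S → Set T} (h0 : D0 step 𝒯) (h1 : D1 step 𝒯) (h2 : D2 step 𝒯) {s z : S}
    {σ : List T} (hσ : TPath step s σ z) (hz : Terminal step z) {u : T} (hu : u ∈ σ) :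
    ∃ s', Reachable (REdge step 𝒯) s s' ∧ Enabled step s' u := by
  have hs : ¬ Terminal step s := by
    cases hσ with
    | nil => simp at hu
    | cons hst _ => exact fun hs => hs _ ⟨_, hst⟩
  obtain ⟨t, s', τ, hst, hτ, hperm⟩ := hσ.exists_rEdge_of_terminal h0 h1 h2 hz hs
  have hlen := hperm.length_eq
  rcases List.mem_cons.1 (hperm.mem_iff.1 hu) with rfl | hu'
  · exact ⟨s, ⟨[], .nil s⟩, s', hst.1⟩
  · obtain ⟨s'', ⟨ρ, hρ⟩, hen⟩ := hτ.exists_reachable_rEdge_enabled h0 h1 h2 hz hu'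
    exact ⟨s'', ⟨t :: ρ, .cons hst hρ⟩, hen⟩
termination_by σ.length
decreasing_by simp_all

/-- Theorem 3: assuming the model is AG EF terminating, the basic strong stubborn
set method preserves the property "`t_s` may become enabled". -/
theorem stmt9 {S T : Type*} (step : S → T → S → Prop) (𝒯 : S → Set T) (sHat : S)
    (hdet : Deterministic step) (h0 : D0 step 𝒯) (h1 : D1 step 𝒯) (h2 : D2 step 𝒯)
    (hAGEF : ∀ s, Reachable step sHat s →
      ∃ s_t, Terminal step s_t ∧ Reachable step s s_t)
    (t_s : T) :
    (∃ s, Reachable step sHat s ∧ Enabled step s t_s) ↔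
      (∃ s, Reachable (REdge step 𝒯) sHat s ∧ Enabled step s t_s) := by
  constructor
  · rintro ⟨s, ⟨σ, hσ⟩, s', hs'⟩
    have hp := hσ.append (.cons hs' (.nil s'))
    obtain ⟨z, hz, τ, hτ⟩ := hAGEF s' ⟨_, hp⟩
    exact (hp.append hτ).exists_reachable_rEdge_enabled h0 h1 h2 hz (by simp)
  · rintro ⟨s, ⟨σ, hσ⟩, hen⟩
    exact ⟨s, ⟨σ, hσ.mono fun _ _ _ h => h.1⟩, hen⟩
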